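/- Let T > 0, let λ : ℕ → [0,∞) be a sequence, let c : [0,T] → ℝ be measurable with 0 ≤ c(t) ≤ μ₂, and let σ and δ be positive real numbers such that either σ > 1/2, or σ = 1/2 and 4δ² ≥ μ₂. Let (u⁰,u¹) ∈ D(A^{1/2}) × H with additionally (u⁰,u¹) ∈ V_{ω_d} for some continuity modulus ω_d, and let u be a solution on [0,T] of the linear equation u'' + 2δ A^σ u' + c(t) A u = 0 with initial data (u⁰,u¹). Then there exists a constant K₁ > 0 depending only on δ and μ₂ with the following property: (u(t),u'(t)) ∈ V_{ω_d} for every t ∈ [0,T], the curves t ↦ ((ω_d(1/λ_k))^{−1/2} λ_k u_k(t))_{k : λ_k>0} and t ↦ ((ω_d(1/λ_k))^{−1/2} u_k'(t))_{k : λ_k>0} are continuous with values in ℓ², and for every ν ≥ 1 with 4δ²ν^{4σ−2} ≥ μ₂ one has ‖(u(t),u'(t))‖_{ω_d}² ≤ K₁ e^{ν(1+μ₂)t} ‖(u⁰,u¹)‖_{ω_d}² for every t ∈ [0,T]. -/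

import Mathlib

open Set Filter MeasureTheory Topology

noncomputable section

/-- A continuity modulus: continuous on `[0,∞)`, vanishing at `0`, positive for positive
arguments, nondecreasing, and such that `x ↦ x / ω x` is nondecreasing on `(0,∞)`. -/
def IsModulus (ω : ℝ → ℝ) : Prop :=
  ContinuousOn ω (Ici 0) ∧ ω 0 = 0 ∧ (∀ x : ℝ, 0 < x → 0 < ω x) ∧
  (∀ x y : ℝ, 0 ≤ x → x ≤ y → ω x ≤ ω y) ∧
  (∀ x y : ℝ, 0 < x → x ≤ y → x / ω x ≤ y / ω y)

/-- The curve `t ↦ (v t k)_k` takes values in `ℓ²` and is continuous on `I`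
with respect to the `ℓ²` norm. -/
def L2Cont (I : Set ℝ) (v : ℝ → ℕ → ℝ) : Prop :=
  (∀ t ∈ I, Summable fun k => (v t k) ^ 2) ∧
  ∀ t ∈ I, ∀ ε : ℝ, 0 < ε → ∃ η > (0:ℝ), ∀ s ∈ I, |s - t| < η →
    (∑' k, (v s k - v t k) ^ 2) < ε

/-- A solution on `[0,T]` of the linear equation `u'' + 2δ A^σ u' + c(t) A u = 0` with
initial data `(u0, u1)`, in the diagonal setting.  Each component `u k` is `C¹` with
derivative `v k`, and `v k` is absolutely continuous with the equation holding a.e.,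
which is encoded through the integral formulation; moreover the curves `t ↦ u(t)`,
`t ↦ A^{1/2}u(t)`, `t ↦ u'(t)` are continuous with values in `ℓ²`. -/
def IsLinearSol (lam : ℕ → ℝ) (c : ℝ → ℝ) (σ δ : ℝ) (T : ℝ)
    (u0 u1 : ℕ → ℝ) (u v : ℕ → ℝ → ℝ) : Prop :=
  (∀ k, u k 0 = u0 k) ∧
  (∀ k, v k 0 = u1 k) ∧
  (∀ k, ∀ t ∈ Icc (0:ℝ) T, HasDerivWithinAt (u k) (v k t) (Icc 0 T) t) ∧
  (∀ k, ∀ t ∈ Icc (0:ℝ) T, v k t = u1 k - ∫ s in (0:ℝ)..t,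
      (2 * δ * lam k ^ (2 * σ) * v k s + c s * lam k ^ 2 * u k s)) ∧
  L2Cont (Icc 0 T) (fun t k => u k t) ∧
  L2Cont (Icc 0 T) (fun t k => lam k * u k t) ∧
  L2Cont (Icc 0 T) (fun t k => v k t)

/-- The `k`-th summand of the squared seminorm `‖(u0,u1)‖_{ωd}²` of the interpolation
space `V_{ωd}`: it equals `((u1 k)² + (lam k)² (u0 k)²) / ωd (1 / lam k)` when
`lam k > 0`, and `0` otherwise. -/
def Vsum (lam : ℕ → ℝ) (ωd : ℝ → ℝ) (u0 u1 : ℕ → ℝ) (k : ℕ) : ℝ :=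
  if 0 < lam k then (u1 k ^ 2 + lam k ^ 2 * u0 k ^ 2) / ωd (1 / lam k) else 0

/-- Membership in the interpolation space `V_{ωd}` (inside `D(A^{1/2}) × H`). -/
def MemV (lam : ℕ → ℝ) (ωd : ℝ → ℝ) (u0 u1 : ℕ → ℝ) : Prop :=
  (Summable fun k => u0 k ^ 2) ∧ (Summable fun k => lam k ^ 2 * u0 k ^ 2) ∧
  (Summable fun k => u1 k ^ 2) ∧ Summable (Vsum lam ωd u0 u1)

/-- Gronwall's inequality for an absolutely continuous function, with the differential
inequality holding almost everywhere. -/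
lemma AbsolutelyContinuousOnInterval.le_exp_mul_of_ae_deriv_le {y : ℝ → ℝ} {L T : ℝ}
    (hy : AbsolutelyContinuousOnInterval y 0 T)
    (hd : ∀ᵐ x, x ∈ Icc (0:ℝ) T → ∃ y', HasDerivAt y y' x ∧ y' ≤ L * y x)
    {t : ℝ} (ht : t ∈ Icc (0:ℝ) T) : y t ≤ Real.exp (L * t) * y 0 := by
  have hy' : AbsolutelyContinuousOnInterval y 0 t := hy.mono (by
    rw [uIcc_of_le ht.1, uIcc_of_le (ht.1.trans ht.2)]
    exact Icc_subset_Icc le_rfl ht.2)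
  have he : AbsolutelyContinuousOnInterval (fun x => Real.exp (-L * x)) 0 t :=
    ContDiffOn.absolutelyContinuousOnInterval (by fun_prop)
  have hz := (he.fun_mul hy').integral_deriv_eq_sub
  have hneg : 0 ≤ ∫ x in (0:ℝ)..t, -deriv (fun x => Real.exp (-L * x) * y x) x := by
    refine intervalIntegral.integral_nonneg_of_ae_restrict ht.1 ?_
    refine (ae_restrict_iff' measurableSet_Icc).2 ?_
    filter_upwards [hd] with x hx hxt
    obtain ⟨y', h1, h2⟩ := hx ⟨hxt.1, hxt.2.trans ht.2⟩
    have h3 : HasDerivAt (fun x => Real.exp (-L * x)) (Real.exp (-L * x) * (-L)) x := by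
      simpa using ((hasDerivAt_id x).const_mul (-L)).exp
    rw [(h3.fun_mul h1).deriv]
    have := mul_nonneg (Real.exp_pos (-L * x)).le (sub_nonneg.2 h2)
    simp only [Pi.zero_apply]
    nlinarith
  rw [intervalIntegral.integral_neg, hz] at hneg
  simp only [mul_zero, Real.exp_zero, one_mul] at hneg
  calc y t = Real.exp (L * t) * (Real.exp (-L * t) * y t) := by
        rw [← mul_assoc, ← Real.exp_add]; simp
    _ ≤ _ := mul_le_mul_of_nonneg_left (by linarith) (Real.exp_pos _).le

/-- An absolutely continuous solution `(u, u') = (u, v)` on `[0,T]` of the scalar equation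
`u'' + 2 a u' + c(t) l² u = 0`. -/
structure IsModeSol (a l : ℝ) (c : ℝ → ℝ) (T : ℝ) (u v : ℝ → ℝ) : Prop where
  acu : AbsolutelyContinuousOnInterval u 0 T
  acv : AbsolutelyContinuousOnInterval v 0 T
  deriv_u : ∀ᵐ x, x ∈ Icc (0:ℝ) T → HasDerivAt u (v x) x
  deriv_v : ∀ᵐ x, x ∈ Icc (0:ℝ) T → HasDerivAt v (-(2 * a * v x + c x * l ^ 2 * u x)) x

namespace IsModeSol

variable {a l μ T : ℝ} {c u v : ℝ → ℝ}

/-- Growth of the hyperbolic energy `u'² + l² u²`. -/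
lemma energy_le (h : IsModeSol a l c T u v) (ha : 0 ≤ a) (hl : 0 ≤ l)
    (hc : ∀ t ∈ Icc (0:ℝ) T, 0 ≤ c t ∧ c t ≤ μ) {t : ℝ} (ht : t ∈ Icc (0:ℝ) T) :
    v t ^ 2 + l ^ 2 * u t ^ 2 ≤
      Real.exp (l * (1 + μ) * t) * (v 0 ^ 2 + l ^ 2 * u 0 ^ 2) := by
  have hac : AbsolutelyContinuousOnInterval (fun x => v x ^ 2 + l ^ 2 * u x ^ 2) 0 T := by
    simp only [pow_two]
    exact (h.acv.fun_mul h.acv).fun_add ((h.acu.fun_mul h.acu).const_mul _)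
  refine hac.le_exp_mul_of_ae_deriv_le ?_ ht
  filter_upwards [h.deriv_u, h.deriv_v] with x hu hv hx
  refine ⟨_, ((hv hx).pow 2).add (((hu hx).pow 2).const_mul _), ?_⟩
  obtain ⟨h0, h1⟩ := hc x hx
  have e1 : 0 ≤ l * ((1 + μ) * (v x ^ 2 + l ^ 2 * u x ^ 2) - 2 * (1 - c x) * v x * (l * u x)) := by
    refine mul_nonneg hl ?_
    nlinarith [mul_nonneg h0 (sq_nonneg (v x + l * u x)), sq_nonneg (v x - l * u x),
      mul_nonneg (sub_nonneg.2 h1) (add_nonneg (sq_nonneg (v x)) (sq_nonneg (l * u x)))]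
  have e2 : 0 ≤ a * v x ^ 2 := by positivity
  norm_num
  nlinarith

/-- In the overdamped regime the energy `(u' + a u)² + a² u²` is nonincreasing. -/
lemma damped_energy_le (h : IsModeSol a l c T u v) (ha : 0 < a) (hal : μ * l ^ 2 ≤ 4 * a ^ 2)
    (hc : ∀ t ∈ Icc (0:ℝ) T, 0 ≤ c t ∧ c t ≤ μ) {t : ℝ} (ht : t ∈ Icc (0:ℝ) T) :
    (v t + a * u t) ^ 2 + a ^ 2 * u t ^ 2 ≤ (v 0 + a * u 0) ^ 2 + a ^ 2 * u 0 ^ 2 := by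
  have hac : AbsolutelyContinuousOnInterval
      (fun x => (v x + a * u x) ^ 2 + a ^ 2 * u x ^ 2) 0 T := by
    simp only [pow_two]
    have hw := h.acv.fun_add (h.acu.const_mul a)
    exact (hw.fun_mul hw).fun_add ((h.acu.fun_mul h.acu).const_mul _)
  have := hac.le_exp_mul_of_ae_deriv_le (L := 0) ?_ ht
  · simpa using this
  filter_upwards [h.deriv_u, h.deriv_v] with x hu hv hx
  refine ⟨_, (((hv hx).add ((hu hx).const_mul a)).pow 2).add (((hu hx).pow 2).const_mul _), ?_⟩
  obtain ⟨h0, h1⟩ := hc x hx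
  set q := c x * l ^ 2 with hq
  have hq0 : 0 ≤ q := by positivity
  have hq1 : q ≤ 4 * a ^ 2 := (mul_le_mul_of_nonneg_right h1 (sq_nonneg l)).trans hal
  have key : 0 ≤ 2 * a * v x ^ 2 + 2 * q * u x * v x + 2 * a * q * u x ^ 2 := by
    have : 0 ≤ (2 * a) * (2 * a * v x ^ 2 + 2 * q * u x * v x + 2 * a * q * u x ^ 2) := by
      nlinarith [sq_nonneg (2 * a * v x + q * u x),
        mul_nonneg (mul_nonneg hq0 (sub_nonneg.2 hq1)) (sq_nonneg (u x))]
    exact nonneg_of_mul_nonneg_right this (by positivity)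
  norm_num
  nlinarith

/-- A bound on `u` gives a bound on `u'` through the damping. -/
lemma velocity_le (h : IsModeSol a l c T u v) (ha : 0 < a) {M : ℝ}
    (hc : ∀ t ∈ Icc (0:ℝ) T, 0 ≤ c t ∧ c t ≤ μ) (hM : ∀ t ∈ Icc (0:ℝ) T, u t ^ 2 ≤ M)
    {t : ℝ} (ht : t ∈ Icc (0:ℝ) T) :
    v t ^ 2 ≤ v 0 ^ 2 + (μ * l ^ 2) ^ 2 * M / (4 * a ^ 2) := by
  set B := (μ * l ^ 2) ^ 2 * M / (4 * a ^ 2) with hB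
  have hM0 : 0 ≤ M := (sq_nonneg _).trans (hM t ht)
  have hB0 : 0 ≤ B := by positivity
  have hac : AbsolutelyContinuousOnInterval (fun x => v x ^ 2 + -B) 0 T := by
    simp only [pow_two]
    exact (h.acv.fun_mul h.acv).fun_add
      (ContDiffOn.absolutelyContinuousOnInterval contDiffOn_const)
  have := hac.le_exp_mul_of_ae_deriv_le (L := -2 * a) ?_ ht
  · have he : Real.exp (-2 * a * t) ≤ 1 := Real.exp_le_one_iff.2 (by nlinarith [ht.1])
    have he0 := Real.exp_pos (-2 * a * t)
    nlinarith [sq_nonneg (v 0)]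
  filter_upwards [h.deriv_v] with x hv hx
  refine ⟨_, ((hv hx).pow 2).add_const _, ?_⟩
  obtain ⟨h0, h1⟩ := hc x hx
  have hq : (c x * l ^ 2 * u x) ^ 2 ≤ 4 * a ^ 2 * B := by
    have : 4 * a ^ 2 * B = (μ * l ^ 2) ^ 2 * M := by rw [hB]; field_simp
    rw [this, mul_pow]
    have := hM x hx
    gcongr
  have key : 0 ≤ a * v x ^ 2 + c x * l ^ 2 * u x * v x + a * B := by
    have : 0 ≤ (4 * a) * (a * v x ^ 2 + c x * l ^ 2 * u x * v x + a * B) := by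
      nlinarith [sq_nonneg (2 * a * v x + c x * l ^ 2 * u x)]
    exact nonneg_of_mul_nonneg_right this (by positivity)
  norm_num
  nlinarith

/-- Uniform bound on `u'² + l² u²` in the overdamped regime. -/
lemma energy_le_of_overdamped (h : IsModeSol a l c T u v) {δ : ℝ} (hδ : 0 < δ) (hl : 0 < l)
    (hal : μ * l ^ 2 ≤ 4 * a ^ 2) (hδa : δ * l ≤ a)
    (hc : ∀ t ∈ Icc (0:ℝ) T, 0 ≤ c t ∧ c t ≤ μ) {t : ℝ} (ht : t ∈ Icc (0:ℝ) T) :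
    v t ^ 2 + l ^ 2 * u t ^ 2 ≤
      (1 + (1 + μ ^ 2 / (4 * δ ^ 2)) * (2 / δ ^ 2 + 3)) * (v 0 ^ 2 + l ^ 2 * u 0 ^ 2) := by
  have ha : 0 < a := (mul_pos hδ hl).trans_le hδa
  have hla : l ^ 2 / a ^ 2 ≤ 1 / δ ^ 2 := by
    rw [div_le_div_iff₀ (by positivity) (by positivity)]
    nlinarith [pow_le_pow_left₀ (by positivity) hδa 2]
  set M := 2 * v 0 ^ 2 / a ^ 2 + 3 * u 0 ^ 2 with hM
  have hu : ∀ s ∈ Icc (0:ℝ) T, u s ^ 2 ≤ M := by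
    intro s hs
    have h1 := h.damped_energy_le ha hal hc hs
    have h2 : a ^ 2 * M = 2 * v 0 ^ 2 + 3 * (a ^ 2 * u 0 ^ 2) := by rw [hM]; field_simp
    refine le_of_mul_le_mul_left (a := a ^ 2) ?_ (by positivity)
    rw [h2]
    nlinarith [sq_nonneg (v s + a * u s), sq_nonneg (v 0 - a * u 0)]
  have hv := h.velocity_le ha hc hu ht
  have hM0 : 0 ≤ M := by positivity
  set E := v 0 ^ 2 + l ^ 2 * u 0 ^ 2 with hE
  have hE0 : 0 ≤ E := by positivity
  have hlM : l ^ 2 * M ≤ (2 / δ ^ 2 + 3) * E := by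
    have e1 : l ^ 2 * M = 2 * v 0 ^ 2 * (l ^ 2 / a ^ 2) + 3 * (l ^ 2 * u 0 ^ 2) := by
      rw [hM]; ring
    have e2 : 2 * v 0 ^ 2 * (l ^ 2 / a ^ 2) ≤ 2 * v 0 ^ 2 * (1 / δ ^ 2) := by gcongr
    have e3 : 2 * v 0 ^ 2 * (1 / δ ^ 2) ≤ 2 * E * (1 / δ ^ 2) := by
      gcongr
      nlinarith [mul_nonneg (sq_nonneg l) (sq_nonneg (u 0))]
    have e4 : 2 * E * (1 / δ ^ 2) = 2 / δ ^ 2 * E := by ring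
    nlinarith [sq_nonneg (v 0)]
  have hB : (μ * l ^ 2) ^ 2 * M / (4 * a ^ 2) ≤ μ ^ 2 / (4 * δ ^ 2) * (l ^ 2 * M) := by
    have e1 : (μ * l ^ 2) ^ 2 * M / (4 * a ^ 2) = μ ^ 2 / 4 * (l ^ 2 * M) * (l ^ 2 / a ^ 2) := by
      ring
    have e2 : μ ^ 2 / (4 * δ ^ 2) * (l ^ 2 * M) = μ ^ 2 / 4 * (l ^ 2 * M) * (1 / δ ^ 2) := by
      ring
    rw [e1, e2]
    gcongr
  have hut := mul_le_mul_of_nonneg_left (hu t ht) (sq_nonneg l)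
  have hv0 : v 0 ^ 2 ≤ E := by nlinarith [mul_nonneg (sq_nonneg l) (sq_nonneg (u 0))]
  have hfin := mul_le_mul_of_nonneg_left hlM
    (show 0 ≤ 1 + μ ^ 2 / (4 * δ ^ 2) by positivity)
  nlinarith

end IsModeSol

lemma L2Cont.continuousOn_apply {I : Set ℝ} {v : ℝ → ℕ → ℝ} (h : L2Cont I v) (k : ℕ) :
    ContinuousOn (fun t => v t k) I := by
  rw [Metric.continuousOn_iff]
  intro t ht ε hε
  obtain ⟨η, hη, H⟩ := h.2 t ht (ε ^ 2) (by positivity)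
  refine ⟨η, hη, fun s hs hst => ?_⟩
  have hsum : Summable fun k => (v s k - v t k) ^ 2 :=
    (((h.1 s hs).add (h.1 t ht)).mul_left 2).of_nonneg_of_le (fun _ => sq_nonneg _)
      fun j => by nlinarith [sq_nonneg (v s j + v t j)]
  have h1 := (hsum.le_tsum k fun _ _ => sq_nonneg _).trans_lt (H s hs hst)
  exact abs_lt_of_sq_lt_sq h1 hε.le

/-- A curve with continuous components whose squares are dominated by a summable sequence is
continuous with values in `ℓ²`. -/
lemma L2Cont.of_dominated {I : Set ℝ} {v : ℝ → ℕ → ℝ} {b : ℕ → ℝ} (hb : Summable b)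
    (hv : ∀ k, ContinuousOn (fun t => v t k) I) (hvb : ∀ t ∈ I, ∀ k, v t k ^ 2 ≤ b k) :
    L2Cont I v := by
  refine ⟨fun t ht => hb.of_nonneg_of_le (fun _ => sq_nonneg _) (hvb t ht), ?_⟩
  intro t ht ε hε
  have hlim : Tendsto (fun s => ∑' k, (v s k - v t k) ^ 2) (𝓝[I] t) (𝓝 (∑' _ : ℕ, (0:ℝ))) := by
    refine tendsto_tsum_of_dominated_convergence (hb.mul_left 4) (fun k => ?_) ?_
    · simpa using ((hv k t ht).tendsto.sub_const (v t k)).pow 2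
    · filter_upwards [self_mem_nhdsWithin] with s hs k
      rw [Real.norm_of_nonneg (sq_nonneg _)]
      nlinarith [hvb s hs k, hvb t ht k, sq_nonneg (v s k + v t k)]
  rw [tsum_zero] at hlim
  obtain ⟨η, hη, H⟩ := Metric.mem_nhdsWithin_iff.1 (hlim.eventually (gt_mem_nhds hε))
  exact ⟨η, hη, fun s hs hst => H ⟨by simpa [Real.dist_eq] using hst, hs⟩⟩

lemma IsLinearSol.isModeSol {lam : ℕ → ℝ} {c : ℝ → ℝ} {σ δ T μ : ℝ} {u0 u1 : ℕ → ℝ}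
    {u v : ℕ → ℝ → ℝ} (h : IsLinearSol lam c σ δ T u0 u1 u v) (hT : 0 < T)
    (hcm : AEMeasurable c (volume.restrict (Icc 0 T)))
    (hc : ∀ t ∈ Icc (0:ℝ) T, 0 ≤ c t ∧ c t ≤ μ) (k : ℕ) :
    IsModeSol (δ * lam k ^ (2 * σ)) (lam k) c T (u k) (v k) := by
  obtain ⟨-, -, hu, hv, hcu, -, hcv⟩ := h
  have hcu := hcu.continuousOn_apply k
  have hcv := hcv.continuousOn_apply k
  set g : ℝ → ℝ := fun s => 2 * δ * lam k ^ (2 * σ) * v k s + c s * lam k ^ 2 * u k s with hg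
  have hgi : IntervalIntegrable g volume 0 T := by
    rw [intervalIntegrable_iff_integrableOn_Icc_of_le hT.le]
    have hci : IntegrableOn c (Icc 0 T) := by
      refine IntegrableOn.of_bound (C := μ) (by simp) hcm.aestronglyMeasurable ?_
      refine (ae_restrict_iff' measurableSet_Icc).2 (.of_forall fun t ht => ?_)
      rw [Real.norm_of_nonneg (hc t ht).1]
      exact (hc t ht).2
    have h1 : IntegrableOn (fun s => 2 * δ * lam k ^ (2 * σ) * v k s) (Icc 0 T) :=
      (hcv.const_mul _).integrableOn_Icc
    have h2 : IntegrableOn (fun s => c s * lam k ^ 2 * u k s) (Icc 0 T) :=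
      IntegrableOn.mul_continuousOn (hci.mul_const (lam k ^ 2)) hcu isCompact_Icc
    exact h1.add h2
  have hIcc : uIcc (0:ℝ) T = Icc 0 T := uIcc_of_le hT.le
  have hga := hgi.absolutelyContinuousOnInterval_intervalIntegral (c := 0) (by simp)
  have hne : ∀ᵐ x : ℝ, x ≠ 0 ∧ x ≠ T := by
    filter_upwards [Measure.ae_ne volume (0:ℝ), Measure.ae_ne volume T] with x h1 h2
    exact ⟨h1, h2⟩
  have hnhds : ∀ᵐ x : ℝ, x ∈ Icc (0:ℝ) T → Icc (0:ℝ) T ∈ 𝓝 x := by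
    filter_upwards [hne] with x hx hxT
    exact Icc_mem_nhds (lt_of_le_of_ne hxT.1 hx.1.symm) (lt_of_le_of_ne hxT.2 hx.2)
  refine ⟨?_, ?_, ?_, ?_⟩
  · obtain ⟨K, hK⟩ := isCompact_Icc.exists_bound_of_continuousOn hcv
    refine LipschitzOnWith.absolutelyContinuousOnInterval (K := K.toNNReal) ?_
    rw [hIcc]
    refine (convex_Icc 0 T).lipschitzOnWith_of_nnnorm_hasDerivWithin_le (hu k) fun x hx => ?_
    exact NNReal.le_toNNReal_of_coe_le (hK x hx)
  · have hac : AbsolutelyContinuousOnInterval (fun t => u1 k - ∫ s in (0:ℝ)..t, g s) 0 T :=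
      (ContDiffOn.absolutelyContinuousOnInterval contDiffOn_const).fun_sub hga
    rw [absolutelyContinuousOnInterval_iff] at hac ⊢
    intro ε hε
    obtain ⟨d, hd, H⟩ := hac ε hε
    refine ⟨d, hd, fun E hE hEd => ?_⟩
    have := H E hE hEd
    refine lt_of_eq_of_lt (Finset.sum_congr rfl fun i hi => ?_) this
    obtain ⟨h1, h2⟩ := hE.1 i hi
    rw [hIcc] at h1 h2
    rw [hv k _ h1, hv k _ h2]
  · filter_upwards [hnhds] with x hx hxT
    exact (hu k x hxT).hasDerivAt (hx hxT)
  · filter_upwards [hnhds, hgi.ae_hasDerivAt_integral] with x hx hgx hxT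
    have h1 := (hgx (hIcc ▸ hxT) 0 (by simp)).const_sub (u1 k)
    have h2 : v k =ᶠ[𝓝 x] fun t => u1 k - ∫ s in (0:ℝ)..t, g s := by
      filter_upwards [hx hxT] with t ht using hv k t ht
    convert! h1.congr_of_eventuallyEq h2 using 1
    simp only [hg]
    ring

lemma IsModulus.pos {ω : ℝ → ℝ} (h : IsModulus ω) {x : ℝ} (hx : 0 < x) : 0 < ω x :=
  h.2.2.1 x hx

lemma Vsum_nonneg {lam : ℕ → ℝ} {ω : ℝ → ℝ} (hω : IsModulus ω) (f g : ℕ → ℝ) (k : ℕ) :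
    0 ≤ Vsum lam ω f g k := by
  unfold Vsum
  split_ifs with h
  · have := hω.pos (one_div_pos.2 h)
    positivity
  · exact le_rfl

/-- Supercritical case: propagation of regularity in the interpolation spaces `V_{ωd}`.
The constant `K₁` depends only on `δ` and `μ₂`. -/
theorem interpolation_regularity_supercritical (δ μ₂ : ℝ) (hδ : 0 < δ) :
    ∃ K₁ > (0:ℝ),
      ∀ T : ℝ, 0 < T → ∀ lam : ℕ → ℝ, (∀ k, 0 ≤ lam k) →
      ∀ c : ℝ → ℝ, AEMeasurable c (volume.restrict (Icc 0 T)) →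
        (∀ t ∈ Icc (0:ℝ) T, 0 ≤ c t ∧ c t ≤ μ₂) →
      ∀ σ : ℝ, 0 < σ → (1 / 2 < σ ∨ (σ = 1 / 2 ∧ μ₂ ≤ 4 * δ ^ 2)) →
      ∀ ωd : ℝ → ℝ, IsModulus ωd →
      ∀ u0 u1 : ℕ → ℝ, MemV lam ωd u0 u1 →
      ∀ u v : ℕ → ℝ → ℝ, IsLinearSol lam c σ δ T u0 u1 u v →
        (∀ t ∈ Icc (0:ℝ) T,
          Summable (Vsum lam ωd (fun k => u k t) (fun k => v k t))) ∧
        L2Cont (Icc 0 T) (fun t k =>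
          if 0 < lam k then lam k * u k t / Real.sqrt (ωd (1 / lam k)) else 0) ∧
        L2Cont (Icc 0 T) (fun t k =>
          if 0 < lam k then v k t / Real.sqrt (ωd (1 / lam k)) else 0) ∧
        ∀ ν : ℝ, 1 ≤ ν → μ₂ ≤ 4 * δ ^ 2 * ν ^ (4 * σ - 2) →
          ∀ t ∈ Icc (0:ℝ) T,
            (∑' k, Vsum lam ωd (fun j => u j t) (fun j => v j t) k) ≤
              K₁ * Real.exp (ν * (1 + μ₂) * t) * ∑' k, Vsum lam ωd u0 u1 k := by
  refine ⟨1 + (1 + μ₂ ^ 2 / (4 * δ ^ 2)) * (2 / δ ^ 2 + 3), by positivity, ?_⟩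
  intro T hT lam hlam c hcm hc σ hσ hσδ ωd hω u0 u1 hV u v hsol
  set K := 1 + (1 + μ₂ ^ 2 / (4 * δ ^ 2)) * (2 / δ ^ 2 + 3) with hK
  have hK1 : 1 ≤ K := by
    rw [hK, le_add_iff_nonneg_right]
    positivity
  have hμ : 0 ≤ μ₂ := (hc 0 ⟨le_rfl, hT.le⟩).1.trans (hc 0 ⟨le_rfl, hT.le⟩).2
  have hσ' : 1 ≤ 2 * σ := by rcases hσδ with h | ⟨h, -⟩ <;> linarith
  have hmode : ∀ ν : ℝ, 1 ≤ ν → μ₂ ≤ 4 * δ ^ 2 * ν ^ (4 * σ - 2) → ∀ t ∈ Icc (0:ℝ) T, ∀ k,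
      0 < lam k → v k t ^ 2 + lam k ^ 2 * u k t ^ 2 ≤
        K * Real.exp (ν * (1 + μ₂) * t) * (u1 k ^ 2 + lam k ^ 2 * u0 k ^ 2) := by
    intro ν hν hνμ t ht k hk
    have hm := hsol.isModeSol hT hcm hc k
    have hE0 : 0 ≤ u1 k ^ 2 + lam k ^ 2 * u0 k ^ 2 := by positivity
    rcases le_total (lam k) ν with hle | hle
    · have h1 := hm.energy_le (by positivity) hk.le hc ht
      rw [hsol.1 k, hsol.2.1 k] at h1
      refine h1.trans (mul_le_mul_of_nonneg_right ?_ hE0)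
      have h2 : Real.exp (lam k * (1 + μ₂) * t) ≤ Real.exp (ν * (1 + μ₂) * t) := by
        have := ht.1
        gcongr
      nlinarith [Real.exp_pos (ν * (1 + μ₂) * t)]
    · have hl1 : 1 ≤ lam k := hν.trans hle
      have hda : δ * lam k ≤ δ * lam k ^ (2 * σ) := by
        gcongr
        exact Real.self_le_rpow_of_one_le hl1 hσ'
      have hal : μ₂ * lam k ^ 2 ≤ 4 * (δ * lam k ^ (2 * σ)) ^ 2 := by
        have e1 : ν ^ (4 * σ - 2) ≤ lam k ^ (4 * σ - 2) :=
          Real.rpow_le_rpow (by linarith) hle (by linarith)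
        have e2 : lam k ^ (4 * σ - 2) * lam k ^ 2 = (lam k ^ (2 * σ)) ^ 2 := by
          rw [← Real.rpow_natCast, ← Real.rpow_natCast, ← Real.rpow_mul hk.le,
            ← Real.rpow_add hk]
          congr 1
          push_cast
          ring
        calc μ₂ * lam k ^ 2 ≤ 4 * δ ^ 2 * lam k ^ (4 * σ - 2) * lam k ^ 2 := by
              have := hνμ.trans (mul_le_mul_of_nonneg_left e1
                (show 0 ≤ 4 * δ ^ 2 by positivity))
              gcongr
          _ = 4 * (δ * lam k ^ (2 * σ)) ^ 2 := by rw [mul_assoc, e2]; ring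
      have h1 := hm.energy_le_of_overdamped hδ hk hal hda hc ht
      rw [hsol.1 k, hsol.2.1 k] at h1
      refine h1.trans (mul_le_mul_of_nonneg_right ?_ hE0)
      have := ht.1
      exact le_mul_of_one_le_right (by positivity) (Real.one_le_exp (by positivity))
  have hVle : ∀ ν : ℝ, 1 ≤ ν → μ₂ ≤ 4 * δ ^ 2 * ν ^ (4 * σ - 2) → ∀ t ∈ Icc (0:ℝ) T, ∀ k,
      Vsum lam ωd (fun j => u j t) (fun j => v j t) k ≤
        K * Real.exp (ν * (1 + μ₂) * t) * Vsum lam ωd u0 u1 k := by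
    intro ν hν hνμ t ht k
    unfold Vsum
    split_ifs with hk
    · have := hω.pos (one_div_pos.2 hk)
      rw [← mul_div_assoc]
      gcongr
      exact hmode ν hν hνμ t ht k hk
    · simp
  obtain ⟨ν, hν, hνμ⟩ : ∃ ν : ℝ, 1 ≤ ν ∧ μ₂ ≤ 4 * δ ^ 2 * ν ^ (4 * σ - 2) := by
    rcases hσδ with h | ⟨h, h'⟩
    · have hlim := (tendsto_rpow_atTop (show 0 < 4 * σ - 2 by linarith)).const_mul_atTop
        (show 0 < 4 * δ ^ 2 by positivity)
      exact ((eventually_ge_atTop 1).and (hlim.eventually_ge_atTop μ₂)).exists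
    · exact ⟨1, le_rfl, by simpa using h'⟩
  have hsum : ∀ C : ℝ, Summable fun k => C * Vsum lam ωd u0 u1 k := fun C => hV.2.2.2.mul_left C
  have hVsum : ∀ t ∈ Icc (0:ℝ) T,
      Summable (Vsum lam ωd (fun k => u k t) (fun k => v k t)) := fun t ht =>
    (hsum _).of_nonneg_of_le (Vsum_nonneg hω _ _) (hVle ν hν hνμ t ht)
  have hbound : ∀ t ∈ Icc (0:ℝ) T, ∀ k, Vsum lam ωd (fun j => u j t) (fun j => v j t) k ≤
      K * Real.exp (ν * (1 + μ₂) * T) * Vsum lam ωd u0 u1 k := by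
    intro t ht k
    refine (hVle ν hν hνμ t ht k).trans ?_
    have := Vsum_nonneg (lam := lam) hω u0 u1 k
    have := ht.2
    gcongr
  refine ⟨hVsum, ?_, ?_, ?_⟩
  · refine L2Cont.of_dominated (hsum (K * Real.exp (ν * (1 + μ₂) * T))) (fun k => ?_)
      fun t ht k => le_trans ?_ (hbound t ht k)
    · split_ifs
      · exact (hsol.2.2.2.2.2.1.continuousOn_apply k).div_const _
      · exact continuousOn_const
    · unfold Vsum
      split_ifs with hk
      · have := hω.pos (one_div_pos.2 hk)
        rw [div_pow, Real.sq_sqrt this.le, mul_pow]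
        gcongr
        exact le_add_of_nonneg_left (sq_nonneg _)
      · simp
  · refine L2Cont.of_dominated (hsum (K * Real.exp (ν * (1 + μ₂) * T))) (fun k => ?_)
      fun t ht k => le_trans ?_ (hbound t ht k)
    · split_ifs
      · exact (hsol.2.2.2.2.2.2.continuousOn_apply k).div_const _
      · exact continuousOn_const
    · unfold Vsum
      split_ifs with hk
      · have := hω.pos (one_div_pos.2 hk)
        rw [div_pow, Real.sq_sqrt this.le]
        gcongr
        exact le_add_of_nonneg_right (by positivity)
      · simp
  · intro ν hν hνμ t ht
    rw [← tsum_mul_left]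
    exact (hVsum t ht).tsum_le_tsum (hVle ν hν hνμ t ht) (hsum _)
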